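/- arXiv:2510.20879 — 8 statements merged into one kernel-verified Lean document; each statement's English description precedes it below -/
import Mathlib

section
/- Let R be an associative unital (possibly noncommutative) ring and let a, b ∈ R satisfy a*b − b*a = b^2. Then for all p ∈ ℕ and all q ≥ 1 one has a^p · b^q = Σ_{j=0}^{p} Γ(p,q,j) · b^{q+j} · a^{p−j}, where the natural numbers Γ(p,q,j) = ((q+j−1)!/(j!·(q−1)!)) · (p!/(p−j)!) act by repeated addition. -/
/-- The coefficients `Γ(p,q,j)` appearing in the identity
`a^p b^q = Σ_j Γ(p,q,j) b^(q+j) a^(p-j)`: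
`Γ(p,q,j) = C(q+j-1, j) · p!/(p-j)!` for `j ≤ p` and `q ≥ 1`,
`Γ(p,0,0) = 1`, and `Γ(p,q,j) = 0` when `j > p` or (`q = 0` and `j ≥ 1`). -/
def Gam (p q j : ℕ) : ℕ :=
  if j ≤ p then
    (if q = 0 then (if j = 0 then 1 else 0)
     else (q + j - 1).choose j * p.descFactorial j)
  else 0

theorem Gam_eq_choose_mul_descFactorial (p m j : ℕ) :
    Gam p (m + 1) j = (m + j).choose j * p.descFactorial j := by
  rw [Gam, if_neg (Nat.succ_ne_zero m), Nat.add_right_comm, Nat.add_sub_cancel]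
  split_ifs with hj
  · rfl
  · rw [Nat.descFactorial_of_lt (not_le.mp hj), mul_zero]

theorem Gam_succ_succ (p m j : ℕ) :
    Gam (p + 1) (m + 1) (j + 1) =
      Gam p (m + 1) (j + 1) + (m + 1 + j) * Gam p (m + 1) j := by
  simp only [Gam_eq_choose_mul_descFactorial, Nat.succ_descFactorial_succ]
  rcases lt_or_ge p j with hpj | hjp
  · simp [Nat.descFactorial_of_lt hpj]
  · obtain ⟨d, rfl⟩ := Nat.exists_eq_add_of_le hjp
    have hchoose := Nat.add_one_mul_choose_eq (m + j) j
    rw [Nat.descFactorial_succ, Nat.add_sub_cancel_left, ← add_assoc]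
    linear_combination (j + d).descFactorial j * hchoose.symm

theorem mul_pow_eq_pow_mul_add_nsmul {R : Type*} [Ring R] {a b : R}
    (h : a * b - b * a = b ^ 2) (n : ℕ) :
    a * b ^ n = b ^ n * a + n • b ^ (n + 1) := by
  induction n with
  | zero => simp
  | succ n ih =>
    have hab : a * b = b * a + b ^ 2 := by rw [← h]; abel
    rw [pow_succ, ← mul_assoc, ih, add_mul, mul_assoc, hab, mul_add, ← mul_assoc,
      ← pow_succ, ← pow_add, smul_mul_assoc, ← pow_succ, succ_nsmul, add_assoc,
      add_comm (b ^ (n + 2))]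

theorem statement0 {R : Type*} [Ring R] (a b : R) (h : a * b - b * a = b ^ 2)
    (p q : ℕ) (hq : 1 ≤ q) :
    a ^ p * b ^ q =
      ∑ j ∈ Finset.range (p + 1), Gam p q j • (b ^ (q + j) * a ^ (p - j)) := by
  obtain ⟨m, rfl⟩ := Nat.exists_eq_add_of_le' hq
  induction p with
  | zero => simp [Gam_eq_choose_mul_descFactorial]
  | succ p ih =>
    have hstep : ∀ j ∈ Finset.range (p + 1),
        a * (Gam p (m + 1) j • (b ^ (m + 1 + j) * a ^ (p - j))) =
          Gam p (m + 1) j • (b ^ (m + 1 + j) * a ^ (p + 1 - j)) +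
            ((m + 1 + j) * Gam p (m + 1) j) •
              (b ^ (m + 1 + (j + 1)) * a ^ (p + 1 - (j + 1))) := by
      intro j hj
      have hjp : j ≤ p := Nat.lt_succ_iff.mp (Finset.mem_range.mp hj)
      rw [mul_smul_comm, ← mul_assoc, mul_pow_eq_pow_mul_add_nsmul h, add_mul, smul_add,
        mul_assoc, ← pow_succ', ← Nat.sub_add_comm hjp, smul_mul_assoc, smul_smul,
        Nat.add_sub_add_right, mul_comm (Gam p (m + 1) j), add_assoc (m + 1) j 1]
    have hlast : Gam p (m + 1) (p + 1) = 0 := by simp [Gam]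
    have hfirst : Gam (p + 1) (m + 1) 0 = Gam p (m + 1) 0 := by simp [Gam]
    have hextend := Finset.sum_range_succ
      (fun j => Gam p (m + 1) j • (b ^ (m + 1 + j) * a ^ (p + 1 - j))) (p + 1)
    rw [hlast, zero_smul, add_zero] at hextend
    rw [pow_succ', mul_assoc, ih, Finset.mul_sum, Finset.sum_congr rfl hstep,
      Finset.sum_add_distrib, ← hextend, Finset.sum_range_succ', Finset.sum_range_succ' _ (p + 1),
      hfirst, add_right_comm, ← Finset.sum_add_distrib]
    simp only [Gam_succ_succ, add_smul]
end

section
/- Let R be an associative unital (possibly noncommutative) ring and let a, b ∈ R satisfy a*b − b*a = b^2. Then for all p ∈ ℕ and all q ≥ 1 one has b^q · a^p = Σ_{j=0}^{p} (−1)^j · Γ(p,q,j) · a^{p−j} · b^{q+j}. -/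
theorem Gam_eq_choose_mul_ascFactorial (p q j : ℕ) (hj : j ≤ p) (hq : 1 ≤ q) :
    Gam p q j = p.choose j * q.ascFactorial j := by
  rw [Gam, if_pos hj, if_neg (by omega), Nat.descFactorial_eq_factorial_mul_choose,
    Nat.ascFactorial_eq_factorial_mul_choose']
  ring

theorem choose_mul_ascFactorial_succ (p q j : ℕ) :
    (p + 1).choose (j + 1) * q.ascFactorial (j + 1) =
      p.choose (j + 1) * q.ascFactorial (j + 1) +
        q * (p.choose j * (q + 1).ascFactorial j) := by
  have h : q.ascFactorial (j + 1) = q * (q + 1).ascFactorial j := by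
    rw [Nat.ascFactorial_succ, Nat.succ_ascFactorial]
  rw [Nat.choose_succ_succ, h]
  ring

section

variable {R : Type*} [Ring R] {a b : R}

theorem pow_mul_of_commutator_eq_sq (h : a * b - b * a = b ^ 2) (q : ℕ) :
    b ^ q * a = a * b ^ q - (q : ℤ) • b ^ (q + 1) := by
  induction q with
  | zero => simp
  | succ n ih =>
    have hba : b * a = a * b - b ^ 2 := by rw [← h]; abel
    rw [pow_succ, mul_assoc, hba, mul_sub, ← mul_assoc, ih, sub_mul, smul_mul_assoc,
      ← pow_succ, ← pow_add, mul_assoc, ← pow_succ]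
    push_cast
    rw [add_smul, one_smul]
    abel

theorem pow_mul_pow_of_commutator_eq_sq (h : a * b - b * a = b ^ 2) (p q : ℕ) :
    b ^ q * a ^ p =
      ∑ j ∈ Finset.range (p + 1),
        ((-1 : ℤ) ^ j * (p.choose j * q.ascFactorial j : ℕ)) •
          (a ^ (p - j) * b ^ (q + j)) := by
  induction p generalizing q with
  | zero => simp
  | succ p ih =>
    have hleft : a * (b ^ q * a ^ p) =
        ∑ j ∈ Finset.range (p + 1 + 1),
          ((-1 : ℤ) ^ j * (p.choose j * q.ascFactorial j : ℕ)) •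
            (a ^ (p + 1 - j) * b ^ (q + j)) := by
      rw [Finset.sum_range_succ, ih, Finset.mul_sum]
      simp only [Nat.choose_succ_self, zero_mul, Nat.cast_zero, mul_zero, zero_smul, add_zero]
      refine Finset.sum_congr rfl fun j hj => ?_
      have hj' : p + 1 - j = p - j + 1 := by
        have := Finset.mem_range.mp hj
        omega
      rw [hj', pow_succ', mul_smul_comm, mul_assoc]
    rw [pow_succ', ← mul_assoc, pow_mul_of_commutator_eq_sq h, sub_mul, mul_assoc, hleft,
      smul_mul_assoc, ih, Finset.sum_range_succ', Finset.sum_range_succ' _ (p + 1),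
      Finset.smul_sum, add_sub_right_comm, ← Finset.sum_sub_distrib]
    congr 1
    · refine Finset.sum_congr rfl fun j _ => ?_
      rw [choose_mul_ascFactorial_succ, smul_smul, Nat.add_sub_add_right,
        show q + 1 + j = q + (j + 1) by ring, ← sub_smul]
      congr 1
      push_cast
      ring
    · simp

end

theorem statement1 {R : Type*} [Ring R] (a b : R) (h : a * b - b * a = b ^ 2)
    (p q : ℕ) (hq : 1 ≤ q) :
    b ^ q * a ^ p =
      ∑ j ∈ Finset.range (p + 1),
        ((-1 : ℤ) ^ j * Gam p q j) • (a ^ (p - j) * b ^ (q + j)) := by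
  rw [pow_mul_pow_of_commutator_eq_sq h]
  refine Finset.sum_congr rfl fun j hj => ?_
  rw [Gam_eq_choose_mul_ascFactorial p q j (by have := Finset.mem_range.mp hj; omega) hq]
end

section
/- For all p ∈ ℕ, q ≥ 1 and all j with 1 ≤ j ≤ p+1, the coefficients Γ satisfy the two recursion relations: Γ(p+1,q,j) = Γ(p,q,j) + (q+j−1)·Γ(p,q,j−1) and Γ(p+1,q,j) = Γ(p,q,j) + q·Γ(p,q+1,j−1). -/
theorem Gam_succ (p r j : ℕ) :
    Gam p (r + 1) j = (r + j).choose j * p.descFactorial j := by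
  rw [Gam, if_neg r.succ_ne_zero, show r + 1 + j - 1 = r + j by omega]
  split_ifs with h
  · rfl
  · rw [Nat.descFactorial_of_lt (not_le.mp h), mul_zero]

theorem Nat.succ_descFactorial_succ_eq_add {p k : ℕ} (h : k ≤ p) :
    (p + 1).descFactorial (k + 1) = p.descFactorial (k + 1) + (k + 1) * p.descFactorial k := by
  rw [Nat.succ_descFactorial_succ, Nat.descFactorial_succ, ← add_mul]
  congr 1
  omega

theorem statement2 (p q j : ℕ) (hq : 1 ≤ q) (hj : 1 ≤ j) (hjp : j ≤ p + 1) :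
    Gam (p + 1) q j = Gam p q j + (q + j - 1) * Gam p q (j - 1) ∧
    Gam (p + 1) q j = Gam p q j + q * Gam p (q + 1) (j - 1) := by
  obtain ⟨r, rfl⟩ := Nat.exists_eq_add_of_le' hq
  obtain ⟨k, rfl⟩ := Nat.exists_eq_add_of_le' hj
  have hk : k ≤ p := by omega
  have absorb : (r + k + 1) * (r + k).choose k = (r + k + 1).choose (k + 1) * (k + 1) :=
    Nat.add_one_mul_choose_eq (r + k) k
  have shift : (r + k + 1).choose (k + 1) * (k + 1) = (r + k + 1).choose k * (r + 1) := by
    rw [Nat.choose_succ_right_eq, show r + k + 1 - k = r + 1 by omega]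
  simp only [Gam_succ, Nat.add_sub_cancel, Nat.succ_descFactorial_succ_eq_add hk,
    show r + 1 + (k + 1) - 1 = r + k + 1 by omega, show r + (k + 1) = r + k + 1 by omega,
    show r + 1 + k = r + k + 1 by omega]
  constructor
  · rw [← mul_assoc (r + k + 1), absorb]
    ring
  · rw [mul_add, ← mul_assoc, shift]
    ring
end

section
/- Let R be an associative unital ℂ-algebra and a, b ∈ R with a*b − b*a = b^2. Then for every x ∈ ℂ and every p ∈ ℕ one has (a + x·b)^p = Σ_{j=0}^{p} γ_j(x)·C(p,j) · b^j · a^{p−j}, where γ_j(x) = (x+j−1)(x+j−2)⋯x is the ascending factorial and C(p,j) is the binomial coefficient. -/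
theorem mul_pow_of_commutator_eq_sq {R : Type*} [Ring R] {a b : R}
    (h : a * b - b * a = b ^ 2) (j : ℕ) :
    a * b ^ j = b ^ j * a + (j : R) * b ^ (j + 1) := by
  induction j with
  | zero => simp
  | succ j ih =>
    have hab : a * b = b * a + b ^ 2 := by rw [← h]; abel
    calc a * b ^ (j + 1) = a * b ^ j * b := by rw [pow_succ, mul_assoc]
      _ = b ^ j * (a * b) + (j : R) * b ^ (j + 1 + 1) := by
        rw [ih, add_mul, mul_assoc, mul_assoc, ← pow_succ]
      _ = b ^ (j + 1) * a + ((j + 1 : ℕ) : R) * b ^ (j + 1 + 1) := by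
        rw [hab, mul_add, ← mul_assoc, ← pow_succ, ← pow_add]
        push_cast
        rw [add_mul, one_mul, add_assoc, add_comm (b ^ (j + 2))]

theorem add_smul_mul_pow_mul_pow {R : Type*} [Ring R] [Algebra ℂ R] {a b : R}
    (h : a * b - b * a = b ^ 2) (x : ℂ) (j k : ℕ) :
    (a + x • b) * (b ^ j * a ^ k) =
      b ^ j * a ^ (k + 1) + (x + (j : ℂ)) • (b ^ (j + 1) * a ^ k) := by
  have hj : (j : R) * b ^ (j + 1) = (j : ℂ) • b ^ (j + 1) := by
    rw [Algebra.smul_def, map_natCast]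
  rw [← mul_assoc, add_mul, mul_pow_of_commutator_eq_sq h, hj, smul_mul_assoc, ← pow_succ',
    add_assoc, ← add_smul, add_mul, mul_assoc, ← pow_succ', smul_mul_assoc, add_comm (j : ℂ)]

theorem statement3 {R : Type*} [Ring R] [Algebra ℂ R] (a b : R)
    (h : a * b - b * a = b ^ 2) (x : ℂ) (p : ℕ) :
    (a + x • b) ^ p =
      ∑ j ∈ Finset.range (p + 1),
        ((∏ i ∈ Finset.range j, (x + (i : ℂ))) * (p.choose j : ℂ)) •
          (b ^ j * a ^ (p - j)) := by
  induction p with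
  | zero => simp
  | succ p ih =>
    set g : ℕ → ℂ := fun j => ∏ i ∈ Finset.range j, (x + (i : ℂ)) with hg
    have hsucc (j : ℕ) : g (j + 1) = g j * (x + (j : ℂ)) := Finset.prod_range_succ _ _
    have hshift : ∑ j ∈ Finset.range (p + 1), (g j * (p.choose j : ℂ)) •
          (b ^ j * a ^ (p - j + 1)) =
        ∑ j ∈ Finset.range (p + 1), (g (j + 1) * (p.choose (j + 1) : ℂ)) •
          (b ^ (j + 1) * a ^ (p - j)) + a ^ (p + 1) := by
      have hlast := Finset.sum_range_succ
        (fun j => (g j * (p.choose j : ℂ)) • (b ^ j * a ^ (p + 1 - j))) (p + 1)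
      rw [Finset.sum_range_succ'] at hlast
      simp only [Nat.choose_succ_self, Nat.cast_zero, mul_zero, zero_smul, add_zero,
        Nat.add_sub_add_right] at hlast
      rw [Finset.sum_congr rfl fun j hj => by
        rw [← Nat.sub_add_comm (Nat.lt_succ_iff.mp (Finset.mem_range.mp hj))], ← hlast]
      simp [hg]
    change _ = ∑ j ∈ Finset.range (p + 1), (g j * (p.choose j : ℂ)) • (b ^ j * a ^ (p - j)) at ih
    change _ = ∑ j ∈ Finset.range (p + 1 + 1),
      (g j * ((p + 1).choose j : ℂ)) • (b ^ j * a ^ (p + 1 - j))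
    rw [pow_succ', ih, Finset.mul_sum, Finset.sum_range_succ' _ (p + 1)]
    simp only [mul_smul_comm, add_smul_mul_pow_mul_pow h, smul_add, Finset.sum_add_distrib,
      smul_smul]
    rw [hshift, add_right_comm, ← Finset.sum_add_distrib]
    congr 1
    · refine Finset.sum_congr rfl fun j _ => ?_
      rw [← add_smul, Nat.add_sub_add_right, Nat.choose_succ_succ, hsucc]
      push_cast
      congr 1
      ring
    · simp [hg]
end

section
/- Let R be an associative unital ℂ-algebra and a, b ∈ R with a*b − b*a = b^2. Then for every x ∈ ℂ and all integers p, q ≥ 0 one has (a + x·b)^p · b^q = b^q · (a + (x+q)·b)^p. In particular (taking x = −q) one has (a − q·b)^p · b^q = b^q · a^p. -/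
theorem semiconjBy_add_smul {R : Type*} [Ring R] [Algebra ℂ R] {a b : R}
    (h : a * b - b * a = b ^ 2) (x : ℂ) :
    SemiconjBy b (a + (x + 1) • b) (a + x • b) := by
  have hab : a * b = b ^ 2 + b * a := sub_eq_iff_eq_add.mp h
  simp only [SemiconjBy, mul_add, add_mul, add_smul, one_smul, mul_smul_comm, smul_mul_assoc,
    hab, pow_two]
  abel

theorem pow_semiconjBy_add_smul {R : Type*} [Ring R] [Algebra ℂ R] {a b : R}
    (h : a * b - b * a = b ^ 2) (x : ℂ) (q : ℕ) :
    SemiconjBy (b ^ q) (a + (x + (q : ℂ)) • b) (a + x • b) := by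
  induction q with
  | zero => simp
  | succ q ih =>
    rw [pow_succ, Nat.cast_succ, ← add_assoc]
    exact ih.mul_left (semiconjBy_add_smul h _)

theorem statement4 {R : Type*} [Ring R] [Algebra ℂ R] (a b : R)
    (h : a * b - b * a = b ^ 2) (x : ℂ) (p q : ℕ) :
    (a + x • b) ^ p * b ^ q = b ^ q * (a + (x + (q : ℂ)) • b) ^ p ∧
    (a - (q : ℂ) • b) ^ p * b ^ q = b ^ q * a ^ p := by
  have key (y : ℂ) : (a + y • b) ^ p * b ^ q = b ^ q * (a + (y + (q : ℂ)) • b) ^ p :=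
    ((pow_semiconjBy_add_smul h y q).pow_right p).eq.symm
  refine ⟨key x, ?_⟩
  simpa only [neg_smul, ← sub_eq_add_neg, neg_add_cancel, zero_smul, add_zero] using key (-(q : ℂ))
end

section
/- Let R be an associative unital ℂ-algebra and a, b ∈ R with a*b − b*a = b^2. Then for every λ ∈ ℂ and every integer m ≥ 1 one has the division identity a^m = Q_{m−1}(λ)·(a − λ·b) + γ_m(λ)·b^m, where Q_{m−1}(λ) := Σ_{j=0}^{m−1} γ_j(λ) · a^{m−1−j} · b^j and γ_j(λ) = λ(λ+1)⋯(λ+j−1) is the ascending factorial. -/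
theorem pow_mul_sub_smul {K R : Type*} [CommRing K] [Ring R] [Algebra K R] {a b : R}
    (h : a * b - b * a = b ^ 2) (c : K) (j : ℕ) :
    b ^ j * (a - c • b) = a * b ^ j - (c + (j : K)) • b ^ (j + 1) := by
  induction j with
  | zero => simp
  | succ j ih =>
    have hba : b * a = a * b - b ^ 2 := by rw [← h]; abel
    rw [pow_succ' b j, mul_assoc, ih, mul_sub, ← mul_assoc, hba, mul_smul_comm, ← pow_succ',
      sub_mul, ← pow_add, mul_assoc, ← pow_succ', add_comm 2 j, Nat.cast_succ, ← add_assoc,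
      add_smul _ (1 : K), one_smul]
    abel

theorem statement5 {R : Type*} [Ring R] [Algebra ℂ R] (a b : R)
    (h : a * b - b * a = b ^ 2) (lam : ℂ) (m : ℕ) (hm : 1 ≤ m) :
    a ^ m =
      (∑ j ∈ Finset.range m,
          (∏ i ∈ Finset.range j, (lam + (i : ℂ))) • (a ^ (m - 1 - j) * b ^ j)) *
        (a - lam • b) +
      (∏ i ∈ Finset.range m, (lam + (i : ℂ))) • b ^ m := by
  have telescope := Finset.sum_range_sub'
    (fun j => (∏ i ∈ Finset.range j, (lam + (i : ℂ))) • (a ^ (m - j) * b ^ j)) m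
  rw [Finset.sum_mul, ← sub_eq_iff_eq_add]
  simp only [Finset.range_zero, Finset.prod_empty, one_smul, Nat.sub_zero, pow_zero, mul_one,
    Nat.sub_self, one_mul] at telescope
  rw [← telescope]
  refine Finset.sum_congr rfl fun j hj => ?_
  have hj' : j < m := Finset.mem_range.mp hj
  rw [smul_mul_assoc, mul_assoc, pow_mul_sub_smul h, mul_sub, ← mul_assoc, ← pow_succ,
    mul_smul_comm, smul_sub, smul_smul, ← Finset.prod_range_succ,
    show m - 1 - j + 1 = m - j by omega, show m - 1 - j = m - (j + 1) by omega]
end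

section
/- Let R be an associative unital (possibly noncommutative) ring and let a, b ∈ R satisfy a*b − b*a = b^2. Then for every N ∈ ℕ one has the identity N! · b^{2N} = Σ_{j=0}^{N} (−1)^j · C(N,j) · b^j · a^N · b^{N−j}, where C(N,j) is the binomial coefficient and integers act by repeated addition. -/
open LinearMap in
theorem mulRight_sub_mulLeft_pow_apply {R : Type*} [Ring R] (b x : R) (n : ℕ) :
    ((mulRight ℤ b - mulLeft ℤ b) ^ n) x =
      ∑ j ∈ Finset.range (n + 1),
        ((-1 : ℤ) ^ j * n.choose j) • (b ^ j * x * b ^ (n - j)) := by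
  have hc : Commute (-mulLeft ℤ b) (mulRight ℤ b) := (commute_mulLeft_right b b).neg_left
  rw [sub_eq_neg_add, hc.add_pow, LinearMap.sum_apply]
  refine Finset.sum_congr rfl fun j _ => ?_
  rw [← nsmul_eq_mul', LinearMap.smul_apply, Module.End.mul_apply, pow_mulRight, neg_pow,
    pow_mulLeft, mul_comm, mul_smul, natCast_zsmul]
  rcases Nat.even_or_odd j with he | he <;> simp [he.neg_one_pow, mul_assoc]

open LinearMap in
theorem mulRight_sub_mulLeft_pow_succ_mul {R : Type*} [Ring R] (a b : R)
    (h : a * b - b * a = b ^ 2) (x : R) (n : ℕ) :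
    ((mulRight ℤ b - mulLeft ℤ b) ^ (n + 1)) (a * x) =
      a * ((mulRight ℤ b - mulLeft ℤ b) ^ (n + 1)) x +
        (n + 1) • (b ^ 2 * ((mulRight ℤ b - mulLeft ℤ b) ^ n) x) := by
  have hab : b * a = a * b - b ^ 2 := by rw [← h]; abel
  have hD (y : R) : (mulRight ℤ b - mulLeft ℤ b) (a * y) =
      a * (mulRight ℤ b - mulLeft ℤ b) y + b ^ 2 * y := by
    simp only [LinearMap.sub_apply, mulRight_apply, mulLeft_apply]
    rw [← mul_assoc b a y, hab]
    noncomm_ring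
  have hb (y : R) : (mulRight ℤ b - mulLeft ℤ b) (b ^ 2 * y) =
      b ^ 2 * (mulRight ℤ b - mulLeft ℤ b) y := by
    simp only [LinearMap.sub_apply, mulRight_apply, mulLeft_apply]
    noncomm_ring
  induction n with
  | zero => simpa using hD x
  | succ n ih =>
    rw [pow_succ', Module.End.mul_apply, ih, map_add, hD, map_nsmul, hb, ← Module.End.mul_apply,
      ← Module.End.mul_apply, ← pow_succ', ← pow_succ', succ_nsmul _ (n + 1)]
    abel

open LinearMap in
theorem mulRight_sub_mulLeft_pow_apply_pow {R : Type*} [Ring R] (a b : R)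
    (h : a * b - b * a = b ^ 2) (n : ℕ) :
    ((mulRight ℤ b - mulLeft ℤ b) ^ n) (a ^ n) = n.factorial • b ^ (2 * n) := by
  induction n with
  | zero => simp
  | succ n ih =>
    have h0 : ((mulRight ℤ b - mulLeft ℤ b) ^ (n + 1)) (a ^ n) = 0 := by
      rw [pow_succ', Module.End.mul_apply, ih, map_nsmul, LinearMap.sub_apply, mulRight_apply,
        mulLeft_apply, ← pow_succ, ← pow_succ', sub_self, smul_zero]
    rw [pow_succ' a, mulRight_sub_mulLeft_pow_succ_mul a b h, h0, ih, mul_zero, zero_add,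
      mul_smul_comm, ← pow_add, smul_smul, Nat.factorial_succ, mul_add_one, add_comm 2]

theorem statement6 {R : Type*} [Ring R] (a b : R) (h : a * b - b * a = b ^ 2) (N : ℕ) :
    N.factorial • b ^ (2 * N) =
      ∑ j ∈ Finset.range (N + 1),
        ((-1 : ℤ) ^ j * N.choose j) • (b ^ j * a ^ N * b ^ (N - j)) := by
  rw [← mulRight_sub_mulLeft_pow_apply, mulRight_sub_mulLeft_pow_apply_pow a b h]
end

section
/- Let R be an associative unital ring that is a ℚ-algebra, let a, b ∈ R satisfy a*b − b*a = b^2, let M be a left R-module, let N ∈ ℕ, and let x ∈ M be such that a^N · (b^k · x) = 0 for every k with 0 ≤ k ≤ N. Then b^{2N} · x = 0. (This is the key step showing that in a small module over the convergent algebra the subspaces of b-torsion and generalized a-torsion coincide and are killed by b^{2N}.) -/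
/-- The inner derivation `y ↦ y * b - b * y` of a ring. -/
def commutatorRight {R : Type*} [Ring R] (b : R) : R →+ R :=
  AddMonoidHom.mulRight b - AddMonoidHom.mulLeft b

theorem commutatorRight_apply {R : Type*} [Ring R] (b y : R) :
    commutatorRight b y = y * b - b * y := rfl

theorem commutatorRight_mul {R : Type*} [Ring R] (b y z : R) :
    commutatorRight b (y * z) = y * commutatorRight b z + commutatorRight b y * z := by
  simp only [commutatorRight_apply, mul_sub, sub_mul, mul_assoc]
  abel

theorem commutatorRight_pow_self {R : Type*} [Ring R] (b : R) (n : ℕ) :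
    commutatorRight b (b ^ n) = 0 := by
  rw [commutatorRight_apply, ← pow_succ, ← pow_succ', sub_self]

theorem iterate_commutatorRight_mul {R : Type*} [Ring R] {a b : R}
    (h : a * b - b * a = b ^ 2) (n : ℕ) (y : R) :
    (commutatorRight b)^[n + 1] (a * y) =
      a * (commutatorRight b)^[n + 1] y + (n + 1) • (b ^ 2 * (commutatorRight b)^[n] y) := by
  have ha : commutatorRight b a = b ^ 2 := h
  induction n with
  | zero => simp [commutatorRight_mul, ha]
  | succ n ih =>
    rw [Function.iterate_succ_apply', ih, map_add, map_nsmul, commutatorRight_mul,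
      commutatorRight_mul, ha, commutatorRight_pow_self, zero_mul, add_zero,
      ← Function.iterate_succ_apply' (commutatorRight b),
      ← Function.iterate_succ_apply' (commutatorRight b), succ_nsmul _ (n + 1), add_assoc,
      add_comm (b ^ 2 * _)]

theorem iterate_succ_commutatorRight_pow {R : Type*} [Ring R] {a b : R}
    (h : a * b - b * a = b ^ 2) (n : ℕ) :
    (commutatorRight b)^[n + 1] (a ^ n) = 0 := by
  induction n with
  | zero => simp [commutatorRight_apply]
  | succ n ih =>
    rw [pow_succ', iterate_commutatorRight_mul h, Function.iterate_succ_apply', ih]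
    simp

theorem iterate_commutatorRight_pow {R : Type*} [Ring R] {a b : R}
    (h : a * b - b * a = b ^ 2) (n : ℕ) :
    (commutatorRight b)^[n] (a ^ n) = n.factorial • b ^ (2 * n) := by
  induction n with
  | zero => simp
  | succ n ih =>
    rw [pow_succ', iterate_commutatorRight_mul h, iterate_succ_commutatorRight_pow h, ih,
      mul_zero, zero_add, mul_smul_comm, ← pow_add, smul_smul, Nat.factorial_succ]
    congr 2
    ring

theorem iterate_commutatorRight_smul_eq_zero {R M : Type*} [Ring R] [AddCommGroup M]
    [Module R M] (b : R) (x : M) (n : ℕ) (y : R)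
    (hy : ∀ k ≤ n, y • (b ^ k • x) = 0) :
    (commutatorRight b)^[n] y • x = 0 := by
  induction n generalizing y with
  | zero => simpa using hy 0 le_rfl
  | succ n ih =>
    rw [Function.iterate_succ_apply]
    refine ih _ fun k hk => ?_
    have hsucc := hy (k + 1) (by omega)
    rw [pow_succ', mul_smul] at hsucc
    rw [commutatorRight_apply, sub_smul, mul_smul, mul_smul, hsucc, hy k (by omega),
      smul_zero, sub_zero]

theorem statement19 {R : Type*} [Ring R] [Algebra ℚ R] (a b : R)
    (h : a * b - b * a = b ^ 2)
    {M : Type*} [AddCommGroup M] [Module R M] (N : ℕ) (x : M)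
    (hx : ∀ k : ℕ, k ≤ N → a ^ N • (b ^ k • x) = 0) :
    b ^ (2 * N) • x = 0 := by
  have key := iterate_commutatorRight_smul_eq_zero b x N (a ^ N) hx
  rw [iterate_commutatorRight_pow h, ← Nat.cast_smul_eq_nsmul ℚ] at key
  have hN : (N.factorial : ℚ) ≠ 0 := by exact_mod_cast N.factorial_ne_zero
  rw [← inv_smul_smul₀ hN (b ^ (2 * N)), ← smul_one_mul (N.factorial : ℚ)⁻¹ (_ : R), mul_smul, key, smul_zero]
end
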